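/- arXiv:2101.07896 — 13 statements merged into one kernel-verified Lean document; each statement's English description precedes it below -/
import Mathlib

section
/- For every j with 1 ≤ j ≤ n, the RSK sequence satisfies the closed form η_j = max_{1 ≤ k ≤ j} ( x_1 + x_2 + ⋯ + x_k + a_k + a_{k+1} + ⋯ + a_j ). -/
/-- Closed form for the RSK recursion:
`η_j = max_{1 ≤ k ≤ j} (x_1 + ⋯ + x_k + a_k + ⋯ + a_j)`. -/
theorem rsk_eta_closed_form (n : ℕ) (hn : 1 ≤ n) (x a : ℕ → ℤ)
    (hx : ∀ i, 0 ≤ x i) (ha : ∀ i, 0 ≤ a i)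
    (ξ η : ℕ → ℤ)
    (hξ : ∀ j, ξ j = ∑ i ∈ Finset.Icc 1 j, x i)
    (hη1 : η 1 = ξ 1 + a 1)
    (hη : ∀ j, 2 ≤ j → j ≤ n → η j = max (η (j - 1)) (ξ j) + a j) :
    ∀ j (h1 : 1 ≤ j), j ≤ n →
      η j = (Finset.Icc 1 j).sup' (Finset.nonempty_Icc.mpr h1)
        (fun k => (∑ i ∈ Finset.Icc 1 k, x i) + ∑ i ∈ Finset.Icc k j, a i) := by
  intro j h1
  induction j, h1 using Nat.le_induction with
  | base => simp [hη1, hξ]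
  | succ j h1 ih =>
    intro hj
    have hsum : ∀ k ≤ j + 1,
        ∑ i ∈ Finset.Icc k (j + 1), a i = ∑ i ∈ Finset.Icc k j, a i + a (j + 1) :=
      fun k hk => Finset.sum_Icc_succ_top hk a
    rw [hη (j + 1) (by omega) hj, Nat.add_sub_cancel, ih (by omega), hξ]
    refine eq_of_forall_ge_iff fun c => ?_
    rw [← le_sub_iff_add_le, max_le_iff, Finset.sup'_le_iff, Finset.sup'_le_iff]
    simp only [Finset.mem_Icc]
    constructor
    · rintro ⟨hprev, hlast⟩ k ⟨hk1, hk⟩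
      rcases Nat.le_succ_iff.mp hk with hkj | rfl
      · have := hprev k ⟨hk1, hkj⟩
        rw [hsum k hk]
        linarith
      · rw [Finset.Icc_self, Finset.sum_singleton]
        linarith
    · intro h
      constructor
      · rintro k ⟨hk1, hkj⟩
        have := h k ⟨hk1, by omega⟩
        rw [hsum k (by omega)] at this
        linarith
      · have := h (j + 1) ⟨by omega, le_rfl⟩
        rw [Finset.Icc_self, Finset.sum_singleton] at this
        linarith
end

section
/- The gRSK data satisfies the following system of equations: b_1 = 1; a_1 x_1 = y_1; a_j x_j = y_j b_j for 2 ≤ j ≤ n; 1/a_1 + 1/x_2 = 1/b_2; and 1/a_j + 1/x_{j+1} = 1/y_j + 1/b_{j+1} for 2 ≤ j ≤ n−1. -/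
/-- The geometric RSK (gRSK) data satisfies the gRSK system of equations. -/
theorem grsk_equations (n : ℕ) (hn : 2 ≤ n) (a x : ℕ → ℝ)
    (ha : ∀ i, 1 ≤ i → i ≤ n → 0 < a i) (hx : ∀ i, 1 ≤ i → i ≤ n → 0 < x i)
    (ξ η y b : ℕ → ℝ)
    (hξ : ∀ j, ξ j = ∏ i ∈ Finset.Icc 1 j, x i)
    (hη1 : η 1 = ξ 1 * a 1)
    (hη : ∀ j, 2 ≤ j → j ≤ n → η j = (η (j - 1) + ξ j) * a j)
    (hy1 : y 1 = η 1)
    (hy : ∀ j, 2 ≤ j → j ≤ n → y j = η j / η (j - 1))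
    (hb1 : b 1 = 1)
    (hb : ∀ j, 2 ≤ j → j ≤ n → b j = a j * x j / y j) :
    b 1 = 1 ∧
    a 1 * x 1 = y 1 ∧
    (∀ j, 2 ≤ j → j ≤ n → a j * x j = y j * b j) ∧
    1 / a 1 + 1 / x 2 = 1 / b 2 ∧
    (∀ j, 2 ≤ j → j ≤ n - 1 → 1 / a j + 1 / x (j + 1) = 1 / y j + 1 / b (j + 1)) := by
  have hξpos : ∀ j, j ≤ n → 0 < ξ j := fun j hj => by
    rw [hξ]
    refine Finset.prod_pos fun i hi => ?_
    rw [Finset.mem_Icc] at hi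
    exact hx i hi.1 (hi.2.trans hj)
  have hξsucc : ∀ j, ξ (j + 1) = ξ j * x (j + 1) := fun j => by
    rw [hξ, hξ, Finset.prod_Icc_succ_top (by omega)]
  have hξ1 : ξ 1 = x 1 := by simp [hξ]
  have hηpos : ∀ j, 1 ≤ j → j ≤ n → 0 < η j := by
    intro j hj
    induction j, hj using Nat.le_induction with
    | base =>
      intro h
      rw [hη1]
      exact mul_pos (hξpos 1 h) (ha 1 le_rfl h)
    | succ j hj ih =>
      intro h
      rw [hη (j + 1) (by omega) h, Nat.add_sub_cancel]
      exact mul_pos (add_pos (ih (by omega)) (hξpos _ h)) (ha _ (by omega) h)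
  have hypos : ∀ j, 2 ≤ j → j ≤ n → 0 < y j := fun j h2 hj => by
    rw [hy j h2 hj]
    exact div_pos (hηpos j (by omega) hj) (hηpos (j - 1) (by omega) (by omega))
  have hbinv : ∀ j, 1 ≤ j → j + 1 ≤ n → 1 / b (j + 1) = 1 / x (j + 1) + ξ j / η j := by
    intro j h1 hj
    have hη0 := (hηpos j h1 (by omega)).ne'
    have ha0 := (ha (j + 1) (by omega) hj).ne'
    have hx0 := (hx (j + 1) (by omega) hj).ne'
    rw [hb _ (by omega) hj, hy _ (by omega) hj, hη _ (by omega) hj, Nat.add_sub_cancel,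
      hξsucc, one_div_div]
    field_simp
  refine ⟨hb1, by rw [hy1, hη1, hξ1, mul_comm], fun j h2 hj => ?_, ?_, fun j h2 hj => ?_⟩
  · rw [hb j h2 hj, mul_div_cancel₀ _ (hypos j h2 hj).ne']
  · have ha0 := (ha 1 le_rfl (by omega)).ne'
    have hξ0 := (hξpos 1 (by omega)).ne'
    rw [hbinv 1 le_rfl hn, hη1]
    field_simp
    ring
  · have ha0 := (ha j (by omega) (by omega)).ne'
    have hη0 := (hηpos j (by omega) (by omega)).ne'
    have hη0' := (hηpos (j - 1) (by omega) (by omega)).ne'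
    have hainv : 1 / a j = (η (j - 1) + ξ j) / η j := by
      rw [div_eq_div_iff ha0 hη0, one_mul]
      exact hη j h2 (by omega)
    rw [hbinv j (by omega) (by omega), hainv, hy j h2 (by omega), one_div_div]
    ring
end

section
/- With y and b the gRSK output of (a, x), the n×n matrix identity U(1/a) · U(1/x) = U(1/y) · V(b) holds, where 1/v denotes the entrywise reciprocal of a tuple v of positive reals. -/
/-- The upper bidiagonal matrix `U(v)` with diagonal `v_1, …, v_n` (1-indexed) and
superdiagonal entries `1`. -/
def Umat (n : ℕ) (v : ℕ → ℝ) : Matrix (Fin n) (Fin n) ℝ :=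
  Matrix.of fun i j =>
    if (j : ℕ) = (i : ℕ) then v ((i : ℕ) + 1)
    else if (j : ℕ) = (i : ℕ) + 1 then 1 else 0

/-- The matrix `V(b)` with `V_{11} = 1`, `V_{ii} = 1/b_i` for `2 ≤ i ≤ n`, `V_{12} = 0`,
`V_{i,i+1} = 1` for `2 ≤ i ≤ n-1`, and all other entries `0` (1-indexed). -/
noncomputable def Vmat (n : ℕ) (b : ℕ → ℝ) : Matrix (Fin n) (Fin n) ℝ :=
  Matrix.of fun i j =>
    if (j : ℕ) = (i : ℕ) then (if (i : ℕ) = 0 then 1 else 1 / b ((i : ℕ) + 1))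
    else if (j : ℕ) = (i : ℕ) + 1 then (if (i : ℕ) = 0 then 0 else 1) else 0

/-- Row `i` of `U(v) M` combines rows `i` and `i + 1` of `M`. -/
theorem Umat_mul_apply (n : ℕ) (v : ℕ → ℝ) (M : Matrix (Fin n) (Fin n) ℝ) (i j : Fin n) :
    (Umat n v * M) i j =
      v ((i : ℕ) + 1) * M i j + if h : (i : ℕ) + 1 < n then M ⟨(i : ℕ) + 1, h⟩ j else 0 := by
  have hrow : ∀ k : Fin n, Umat n v i k * M k j =
      (if k = i then v ((i : ℕ) + 1) * M k j else 0) +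
        if (k : ℕ) = (i : ℕ) + 1 then M k j else 0 := by
    intro k
    simp only [Umat, Matrix.of_apply, Fin.ext_iff]
    split_ifs <;> first | omega | simp
  rw [Matrix.mul_apply, Finset.sum_congr rfl fun k _ => hrow k, Finset.sum_add_distrib,
    Finset.sum_ite_eq' Finset.univ i, if_pos (Finset.mem_univ i)]
  congr 1
  split_ifs with h
  · rw [Finset.sum_eq_single_of_mem (⟨(i : ℕ) + 1, h⟩ : Fin n) (Finset.mem_univ _)]
    · simp
    · intro k _ hk
      exact if_neg fun e => hk (Fin.ext e)
  · refine Finset.sum_eq_zero fun k _ => if_neg ?_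
    omega

/-- Matrix representation of geometric RSK:
`U(1/a) · U(1/x) = U(1/y) · V(b)`. -/
theorem grsk_matrix_identity (n : ℕ) (hn : 2 ≤ n) (a x : ℕ → ℝ)
    (ha : ∀ i, 1 ≤ i → i ≤ n → 0 < a i) (hx : ∀ i, 1 ≤ i → i ≤ n → 0 < x i)
    (ξ η y b : ℕ → ℝ)
    (hξ : ∀ j, ξ j = ∏ i ∈ Finset.Icc 1 j, x i)
    (hη1 : η 1 = ξ 1 * a 1)
    (hη : ∀ j, 2 ≤ j → j ≤ n → η j = (η (j - 1) + ξ j) * a j)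
    (hy1 : y 1 = η 1)
    (hy : ∀ j, 2 ≤ j → j ≤ n → y j = η j / η (j - 1))
    (hb1 : b 1 = 1)
    (hb : ∀ j, 2 ≤ j → j ≤ n → b j = a j * x j / y j) :
    Umat n (fun i => 1 / a i) * Umat n (fun i => 1 / x i)
      = Umat n (fun i => 1 / y i) * Vmat n b := by
  have hξ1 : ξ 1 = x 1 := by simp [hξ]
  have hξ_succ : ∀ j, ξ (j + 1) = ξ j * x (j + 1) := fun j => by
    rw [hξ, hξ, Finset.prod_Icc_succ_top (by omega)]
  have hξ_pos : ∀ j, j ≤ n → 0 < ξ j := fun j hj => by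
    rw [hξ]
    refine Finset.prod_pos fun i hi => ?_
    rw [Finset.mem_Icc] at hi
    exact hx i hi.1 (hi.2.trans hj)
  have hη_succ : ∀ j, j + 2 ≤ n → η (j + 2) = (η (j + 1) + ξ (j + 2)) * a (j + 2) :=
    fun j hj => hη (j + 2) (by omega) hj
  have hη_pos : ∀ j, j + 1 ≤ n → 0 < η (j + 1) := by
    intro j
    induction j with
    | zero =>
      intro h
      rw [zero_add, hη1]
      exact mul_pos (hξ_pos 1 h) (ha 1 le_rfl h)
    | succ j ih =>
      intro h
      rw [hη_succ j h]
      exact mul_pos (add_pos (ih (by omega)) (hξ_pos _ h)) (ha _ (by omega) h)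
  have hy_succ : ∀ j, j + 2 ≤ n → y (j + 2) = η (j + 2) / η (j + 1) :=
    fun j hj => hy (j + 2) (by omega) hj
  have hy_pos : ∀ j, j + 2 ≤ n → 0 < y (j + 2) := fun j hj => by
    rw [hy_succ j hj]
    exact div_pos (hη_pos (j + 1) hj) (hη_pos j (by omega))
  have hb_succ : ∀ j, j + 2 ≤ n → 1 / b (j + 2) = 1 / x (j + 2) + ξ (j + 1) / η (j + 1) := by
    intro j hj
    have h1 := ha (j + 2) (by omega) hj
    have h2 := hx (j + 2) (by omega) hj
    have h3 := hη_pos j (by omega)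
    rw [hb _ (by omega) hj, one_div_div, hy_succ j hj, hη_succ j hj, hξ_succ (j + 1)]
    field_simp
  have hdiag : ∀ j, j + 2 ≤ n → 1 / y (j + 2) * (1 / b (j + 2)) =
      1 / a (j + 2) * (1 / x (j + 2)) := by
    intro j hj
    have h1 := hy_pos j hj
    rw [hb _ (by omega) hj]
    field_simp
  have hdiag_one : 1 / y 1 = 1 / a 1 * (1 / x 1) := by
    rw [hy1, hη1, hξ1, one_div_mul_one_div, mul_comm]
  have hsuper_one : 1 / b 2 = 1 / a 1 + 1 / x 2 := by
    have h1 := hξ_pos 1 (by omega)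
    rw [hb_succ 0 hn, zero_add, hη1, add_comm, div_mul_cancel_left₀ h1.ne', one_div (a 1)]
  have hsuper : ∀ j, j + 3 ≤ n → 1 / y (j + 2) + 1 / b (j + 3) =
      1 / a (j + 2) + 1 / x (j + 3) := by
    intro j hj
    have h1 := ha (j + 2) (by omega) (by omega)
    have h2 := hη_pos (j + 1) (by omega)
    have key : η (j + 1) / η (j + 2) + ξ (j + 2) / η (j + 2) = 1 / a (j + 2) := by
      rw [← add_div, div_eq_div_iff h2.ne' h1.ne', one_mul, hη_succ j (by omega)]
    rw [hb_succ (j + 1) hj, hy_succ j (by omega), one_div_div]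
    linarith
  ext ⟨i, hi⟩ ⟨j, hj⟩
  rw [Umat_mul_apply, Umat_mul_apply]
  simp only [Umat, Vmat, Matrix.of_apply]
  rcases eq_or_ne j i with rfl | h0
  · rcases j with _ | j
    · simpa using hdiag_one.symm
    · simpa using (hdiag j hi).symm
  rcases eq_or_ne j (i + 1) with rfl | h1
  · rcases i with _ | i
    · simpa [hj] using hsuper_one.symm
    · simpa [hj] using (hsuper i hj).symm
  · by_cases h2 : i + 1 < n <;> simp [h0, h1, h2]
end

section
/- For every i with 1 ≤ i ≤ n−1, b_{i+1} = x_{i+1} + (a_1 a_2 ⋯ a_i)/(b_2 b_3 ⋯ b_i), where the empty product (for i = 1 in the denominator) is 1. In particular the geometric RSK evolution is expressed in subtraction-free form. -/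
/-- The geometric RSK evolution in subtraction-free form:
`b_{i+1} = x_{i+1} + (a_1 ⋯ a_i)/(b_2 ⋯ b_i)` for `1 ≤ i ≤ n-1`. -/
theorem grsk_subtraction_free (n : ℕ) (hn : 2 ≤ n) (a x y b : ℕ → ℝ)
    (ha : ∀ i, 1 ≤ i → i ≤ n → 0 < a i) (hx : ∀ i, 1 ≤ i → i ≤ n → 0 < x i)
    (hy : ∀ i, 1 ≤ i → i ≤ n → 0 < y i) (hbpos : ∀ i, 1 ≤ i → i ≤ n → 0 < b i)
    (hb1 : b 1 = 1)
    (hy1 : y 1 = a 1 * x 1)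
    (hyb : ∀ i, 2 ≤ i → i ≤ n → y i * b i = a i * x i)
    (hb2 : b 2 = a 1 + x 2)
    (hrec : ∀ i, 2 ≤ i → i ≤ n - 1 → y i + b (i + 1) = a i + x (i + 1)) :
    ∀ i, 1 ≤ i → i ≤ n - 1 →
      b (i + 1) = x (i + 1) +
        (∏ j ∈ Finset.Icc 1 i, a j) / (∏ j ∈ Finset.Icc 2 i, b j) := by
  intro i hi
  induction i, hi using Nat.le_induction with
  | base => intro _; simp [hb2, add_comm]
  | succ i hi ih =>
    intro hin
    have hb : b (i + 1) ≠ 0 := (hbpos (i + 1) (by omega) (by omega)).ne'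
    have hy_eq : y (i + 1) = a (i + 1) * x (i + 1) / b (i + 1) :=
      eq_div_of_mul_eq hb (hyb (i + 1) (by omega) (by omega))
    have hratio : (∏ j ∈ Finset.Icc 1 i, a j) / (∏ j ∈ Finset.Icc 2 i, b j) =
        b (i + 1) - x (i + 1) := by
      linarith [ih (by omega)]
    rw [Finset.prod_Icc_succ_top (by omega), Finset.prod_Icc_succ_top (by omega),
      mul_div_mul_comm, hratio]
    have hsplit : (b (i + 1) - x (i + 1)) * (a (i + 1) / b (i + 1)) =
        a (i + 1) - a (i + 1) * x (i + 1) / b (i + 1) := by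
      field_simp
    linarith [hrec (i + 1) (by omega) hin]
end

section
/- For all real numbers a and b, the limit as ε tends to 0 from the right of −ε · ln( e^{−a/ε} + e^{−b/ε} ) equals min(a, b). (This is the limit used to ultradiscretise subtraction-free rational expressions into min-plus form.) -/
theorem neg_mul_log_exp_add_exp_le (a b : ℝ) {ε : ℝ} (hε : 0 < ε) :
    -ε * Real.log (Real.exp (-a / ε) + Real.exp (-b / ε)) ≤ a := by
  have h : -a / ε ≤ Real.log (Real.exp (-a / ε) + Real.exp (-b / ε)) :=
    (Real.le_log_iff_exp_le (by positivity)).2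
      (le_add_of_nonneg_right (Real.exp_pos _).le)
  rw [div_le_iff₀ hε] at h
  linarith

theorem min_sub_mul_log_two_le (a b : ℝ) {ε : ℝ} (hε : 0 < ε) :
    min a b - ε * Real.log 2 ≤
      -ε * Real.log (Real.exp (-a / ε) + Real.exp (-b / ε)) := by
  have ha : Real.exp (-a / ε) ≤ Real.exp (-min a b / ε) := by
    gcongr
    exact min_le_left a b
  have hb : Real.exp (-b / ε) ≤ Real.exp (-min a b / ε) := by
    gcongr
    exact min_le_right a b
  have h : Real.log (Real.exp (-a / ε) + Real.exp (-b / ε)) ≤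
      Real.log 2 + -min a b / ε := by
    rw [← Real.log_exp (-min a b / ε), ← Real.log_mul two_ne_zero (Real.exp_ne_zero _)]
    exact Real.log_le_log (by positivity) (by linarith)
  have h' := mul_le_mul_of_nonneg_left h hε.le
  rw [mul_add, mul_div_cancel₀ _ hε.ne'] at h'
  linarith


/-- Ultradiscretisation limit:
`−ε · ln(e^{−a/ε} + e^{−b/ε}) → min(a, b)` as `ε → 0⁺`. -/
theorem ultradiscretisation_min (a b : ℝ) :
    Filter.Tendsto
      (fun ε : ℝ => -ε * Real.log (Real.exp (-a / ε) + Real.exp (-b / ε)))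
      (nhdsWithin 0 (Set.Ioi 0)) (nhds (min a b)) := by
  have hlower : Filter.Tendsto (fun ε : ℝ => min a b - ε * Real.log 2)
      (nhdsWithin 0 (Set.Ioi 0)) (nhds (min a b)) := by
    have hcont : Continuous fun ε : ℝ => min a b - ε * Real.log 2 := by fun_prop
    simpa using (hcont.tendsto 0).mono_left nhdsWithin_le_nhds
  refine tendsto_of_tendsto_of_tendsto_of_le_of_le' hlower tendsto_const_nhds ?_ ?_
  · filter_upwards [self_mem_nhdsWithin] with ε hε
    exact min_sub_mul_log_two_le a b hε
  · filter_upwards [self_mem_nhdsWithin] with ε hε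
    refine le_min (neg_mul_log_exp_add_exp_le a b hε) ?_
    rw [add_comm]
    exact neg_mul_log_exp_add_exp_le b a hε
end

section
/- The ultradiscretisation of the geometric RSK equations solves the RSK equations for Schensted insertion: one has η_1 = ξ_1 + a_1, and η_j = max(η_{j−1}, ξ_j) + a_j for every j with 2 ≤ j ≤ n. -/
/-- The ultradiscretisation of the geometric RSK equations solves the RSK equations
for Schensted insertion: `η_1 = ξ_1 + a_1` and `η_j = max(η_{j-1}, ξ_j) + a_j`. -/
theorem ud_grsk_solves_rsk (n : ℕ) (hn : 1 ≤ n) (a x : ℕ → ℤ)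
    (ha : ∀ i, 0 ≤ a i) (hx : ∀ i, 0 ≤ x i)
    (b y ξ η : ℕ → ℤ)
    (hb1 : b 1 = 0)
    (hy : ∀ i, 1 ≤ i → i ≤ n → y i = a i + x i - b i)
    (hb : ∀ i, 1 ≤ i → i ≤ n - 1 →
      b (i + 1) = min (x (i + 1))
        ((∑ j ∈ Finset.Icc 1 i, a j) - ∑ j ∈ Finset.Icc 2 i, b j))
    (hξ : ∀ j, ξ j = ∑ i ∈ Finset.Icc 1 j, x i)
    (hη : ∀ j, η j = ∑ i ∈ Finset.Icc 1 j, y i) :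
    η 1 = ξ 1 + a 1 ∧
    ∀ j, 2 ≤ j → j ≤ n → η j = max (η (j - 1)) (ξ j) + a j := by
  have step (f : ℕ → ℤ) (m : ℕ) (k : ℕ) (h : m ≤ k + 1) :
      ∑ i ∈ Finset.Icc m (k + 1), f i = ∑ i ∈ Finset.Icc m k, f i + f (k + 1) :=
    Finset.sum_Icc_succ_top h f
  have row_sum (i : ℕ) (hi : 1 ≤ i) : i ≤ n →
      η i = ξ i + (∑ j ∈ Finset.Icc 1 i, a j - ∑ j ∈ Finset.Icc 2 i, b j) := by
    induction i, hi using Nat.le_induction with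
    | base =>
      intro _
      simp [hη, hξ, hy 1 le_rfl hn, hb1, add_comm]
    | succ k hk ih =>
      intro hkn
      have ih := ih (by omega)
      rw [hη, hξ] at ih ⊢
      rw [step y 1 k (by omega), step x 1 k (by omega), step a 1 k (by omega),
        step b 2 k (by omega), hy (k + 1) (by omega) hkn]
      linarith
  refine ⟨by simpa using row_sum 1 le_rfl hn, fun j hj hjn => ?_⟩
  obtain ⟨k, rfl⟩ : ∃ k, j = k + 1 := ⟨j - 1, by omega⟩
  have hk := row_sum k (by omega) (by omega)
  have hbk := hb k (by omega) (by omega)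
  have hyk := hy (k + 1) (by omega) hjn
  have hηk : η (k + 1) = η k + y (k + 1) := by rw [hη, hη, step y 1 k (by omega)]
  have hξk : ξ (k + 1) = ξ k + x (k + 1) := by rw [hξ, hξ, step x 1 k (by omega)]
  rw [Nat.add_sub_cancel]
  omega
end

section
/- The ultradiscretised geometric RSK system maps nonnegative integer inputs to nonnegative integer outputs: y_1 = a_1 + x_1; for every i with 1 ≤ i ≤ n−1 one has 0 ≤ (a_1+⋯+a_i) − (b_2+⋯+b_i) and 0 ≤ b_{i+1} ≤ x_{i+1}; and for every i with 1 ≤ i ≤ n one has a_i ≤ y_i ≤ a_i + x_i. -/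
/-- The ultradiscretised geometric RSK system maps nonnegative integer inputs to
nonnegative integer outputs. -/
theorem ud_grsk_nonneg (n : ℕ) (hn : 1 ≤ n) (a x : ℕ → ℤ)
    (ha : ∀ i, 0 ≤ a i) (hx : ∀ i, 0 ≤ x i)
    (b y : ℕ → ℤ)
    (hb1 : b 1 = 0)
    (hy : ∀ i, 1 ≤ i → i ≤ n → y i = a i + x i - b i)
    (hb : ∀ i, 1 ≤ i → i ≤ n - 1 →
      b (i + 1) = min (x (i + 1))
        ((∑ j ∈ Finset.Icc 1 i, a j) - ∑ j ∈ Finset.Icc 2 i, b j)) :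
    y 1 = a 1 + x 1 ∧
    (∀ i, 1 ≤ i → i ≤ n - 1 →
      0 ≤ (∑ j ∈ Finset.Icc 1 i, a j) - (∑ j ∈ Finset.Icc 2 i, b j) ∧
      0 ≤ b (i + 1) ∧ b (i + 1) ≤ x (i + 1)) ∧
    (∀ i, 1 ≤ i → i ≤ n → a i ≤ y i ∧ y i ≤ a i + x i) := by
  have slack_nonneg : ∀ i, 1 ≤ i → i ≤ n - 1 →
      0 ≤ (∑ j ∈ Finset.Icc 1 i, a j) - ∑ j ∈ Finset.Icc 2 i, b j := by
    intro i hi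
    induction i, hi using Nat.le_induction with
    | base => simp [ha 1]
    | succ i hi ih =>
      intro hin
      rw [Finset.sum_Icc_succ_top (by omega), Finset.sum_Icc_succ_top (by omega)]
      have hbi := (hb i hi (by omega)).trans_le (min_le_right _ _)
      linarith [ha (i + 1)]
  have b_bounds : ∀ i, 1 ≤ i → i ≤ n - 1 → 0 ≤ b (i + 1) ∧ b (i + 1) ≤ x (i + 1) := by
    intro i hi hin
    rw [hb i hi hin]
    exact ⟨le_min (hx _) (slack_nonneg i hi hin), min_le_left _ _⟩
  refine ⟨by simp [hy 1 le_rfl hn, hb1],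
    fun i hi hin => ⟨slack_nonneg i hi hin, b_bounds i hi hin⟩, fun i hi hin => ?_⟩
  have hbi : 0 ≤ b i ∧ b i ≤ x i := by
    obtain rfl | hi' := hi.eq_or_lt
    · simp [hb1, hx 1]
    · obtain ⟨k, rfl⟩ := Nat.exists_eq_add_of_le' hi
      exact b_bounds k (by omega) (by omega)
  rw [hy i hi hin]
  constructor <;> linarith [hbi.1, hbi.2]
end

section
/- RSK insertion is captured by the box-ball coordinate evolution: applying χ_N with N = n+1 to the tuple determined by Q_1 = 0, W_i = x_i and Q_{i+1} = a_i for 1 ≤ i ≤ n yields Q'_i = b_i for 1 ≤ i ≤ n, W'_i = y_i for 1 ≤ i ≤ n, and Q'_{n+1} = (a_1+⋯+a_n) − (b_2+⋯+b_n), where y and b are the new and bumped words of the Schensted insertion of a into x. -/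
/-- RSK insertion is captured by the box-ball coordinate evolution `χ_{n+1}` applied to
the tuple with `Q_1 = 0`, `W_i = x_i`, `Q_{i+1} = a_i`: the output satisfies
`Q'_i = b_i`, `W'_i = y_i` for `1 ≤ i ≤ n`, and
`Q'_{n+1} = (a_1 + ⋯ + a_n) − (b_2 + ⋯ + b_n)`. -/
theorem rsk_is_boxball_coordinate_evolution (n : ℕ) (hn : 1 ≤ n)
    (x a : ℕ → ℤ) (hx : ∀ i, 0 ≤ x i) (ha : ∀ i, 0 ≤ a i)
    (ξ η y b : ℕ → ℤ)
    (hξ : ∀ j, ξ j = ∑ i ∈ Finset.Icc 1 j, x i)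
    (hη1 : η 1 = ξ 1 + a 1)
    (hη : ∀ j, 2 ≤ j → j ≤ n → η j = max (η (j - 1)) (ξ j) + a j)
    (hy1 : y 1 = η 1)
    (hy : ∀ j, 2 ≤ j → j ≤ n → y j = η j - η (j - 1))
    (hb1 : b 1 = 0)
    (hb : ∀ j, 2 ≤ j → j ≤ n → b j = a j + x j - y j)
    (Q W Q' W' : ℕ → ℤ)
    (hQ1 : Q 1 = 0)
    (hW : ∀ i, 1 ≤ i → i ≤ n → W i = x i)
    (hQ : ∀ i, 1 ≤ i → i ≤ n → Q (i + 1) = a i)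
    (hQ' : ∀ i, 1 ≤ i → i ≤ n →
      Q' i = min (W i)
        ((∑ j ∈ Finset.Icc 1 i, Q j) - ∑ j ∈ Finset.Icc 1 (i - 1), Q' j))
    (hQ'N : Q' (n + 1) =
      (∑ j ∈ Finset.Icc 1 (n + 1), Q j) - ∑ j ∈ Finset.Icc 1 n, Q' j)
    (hW' : ∀ i, 1 ≤ i → i ≤ n → W' i = Q (i + 1) + W i - Q' i) :
    (∀ i, 1 ≤ i → i ≤ n → Q' i = b i ∧ W' i = y i) ∧
    Q' (n + 1) = (∑ j ∈ Finset.Icc 1 n, a j) - ∑ j ∈ Finset.Icc 2 n, b j := by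
  have hξs : ∀ m, ξ (m + 1) = ξ m + x (m + 1) := fun m => by
    rw [hξ, hξ, Finset.sum_Icc_succ_top (by omega)]
  have hξ1 : ξ 1 = x 1 := by simp [hξ]
  have key : ∀ m, m + 1 ≤ n →
      Q' (m + 1) = b (m + 1) ∧ W' (m + 1) = y (m + 1) ∧
      (∑ j ∈ Finset.Icc 1 (m + 2), Q j) - ∑ j ∈ Finset.Icc 1 (m + 1), Q' j
        = η (m + 1) - ξ (m + 1) := by
    intro m
    induction m with
    | zero =>
      intro h
      have hQ'1 : Q' 1 = 0 := by
        rw [hQ' 1 le_rfl hn, hW 1 le_rfl hn]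
        simpa [hQ1] using hx 1
      have hQ2 : Q 2 = a 1 := hQ 1 le_rfl hn
      have hW'1 := hW' 1 le_rfl hn
      have hW1 := hW 1 le_rfl hn
      have hsum : ∑ j ∈ Finset.Icc 1 2, Q j = Q 1 + Q 2 := by
        rw [Finset.sum_Icc_succ_top (by omega)]
        simp
      refine ⟨by simp [hQ'1, hb1], ?_, ?_⟩
      · simp only [zero_add]
        linarith
      · simp only [zero_add, hsum, Finset.Icc_self, Finset.sum_singleton]
        linarith
    | succ m ih =>
      intro h
      obtain ⟨-, -, hsum⟩ := ih (by omega)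
      have hQ'm := hQ' (m + 2) (by omega) h
      have hW'm := hW' (m + 2) (by omega) h
      have hWm := hW (m + 2) (by omega) h
      have hQm : Q (m + 3) = a (m + 2) := hQ (m + 2) (by omega) h
      have hηm := hη (m + 2) (by omega) h
      have hym := hy (m + 2) (by omega) h
      have hbm := hb (m + 2) (by omega) h
      have hξm : ξ (m + 2) = ξ (m + 1) + x (m + 2) := hξs (m + 1)
      simp only [show m + 2 - 1 = m + 1 by omega] at hQ'm hηm hym
      rw [hsum] at hQ'm
      have hQ'b : Q' (m + 2) = b (m + 2) := by omega
      refine ⟨hQ'b, ?_, ?_⟩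
      · change W' (m + 2) = y (m + 2)
        linarith
      · rw [Finset.sum_Icc_succ_top (by omega) Q, Finset.sum_Icc_succ_top (by omega) Q']
        change (∑ j ∈ Finset.Icc 1 (m + 2), Q j) + Q (m + 3)
          - ((∑ j ∈ Finset.Icc 1 (m + 1), Q' j) + Q' (m + 2)) = η (m + 2) - ξ (m + 2)
        linarith
  have hmain : ∀ i, 1 ≤ i → i ≤ n → Q' i = b i ∧ W' i = y i := by
    intro i hi hin
    obtain ⟨m, rfl⟩ := Nat.exists_eq_add_of_le' hi
    exact ⟨(key m hin).1, (key m hin).2.1⟩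
  refine ⟨hmain, ?_⟩
  have hQsum : ∀ k, k ≤ n → ∑ j ∈ Finset.Icc 1 (k + 1), Q j = ∑ j ∈ Finset.Icc 1 k, a j := by
    intro k
    induction k with
    | zero => simp [hQ1]
    | succ k ih =>
      intro h
      rw [Finset.sum_Icc_succ_top (by omega) Q, Finset.sum_Icc_succ_top (by omega) a,
        ih (by omega), hQ (k + 1) (by omega) h]
  have hQ'sum : ∑ j ∈ Finset.Icc 1 n, Q' j = ∑ j ∈ Finset.Icc 2 n, b j := by
    rw [Finset.sum_congr rfl fun j hj =>
      (hmain j (Finset.mem_Icc.1 hj).1 (Finset.mem_Icc.1 hj).2).1,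
      ← Finset.add_sum_Ioc_eq_sum_Icc hn, hb1, zero_add]
    rfl
  rw [hQ'N, hQsum n le_rfl, hQ'sum]
end

section
/- The box-ball coordinate dynamics is well defined on nonnegative coordinates and conserves the total number of balls: if all Q_i and W_i are nonnegative integers then all Q'_i and W'_i are nonnegative integers, with Q'_i ≤ W_i for 1 ≤ i ≤ N−1 and W'_i ≥ Q_{i+1} for 1 ≤ i ≤ N−1; moreover Q'_1 + ⋯ + Q'_N = Q_1 + ⋯ + Q_N, and if Q_1 = 0 then Q'_1 = 0. -/
/-- The box-ball coordinate dynamics is well defined on nonnegative coordinates and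
conserves the total number of balls. -/
theorem boxball_coord_nonneg_conserved (N : ℕ) (hN : 1 ≤ N)
    (Q W Q' W' : ℕ → ℤ)
    (hQnn : ∀ i, 1 ≤ i → i ≤ N → 0 ≤ Q i)
    (hWnn : ∀ i, 1 ≤ i → i ≤ N - 1 → 0 ≤ W i)
    (hQ' : ∀ i, 1 ≤ i → i ≤ N - 1 →
      Q' i = min (W i)
        ((∑ j ∈ Finset.Icc 1 i, Q j) - ∑ j ∈ Finset.Icc 1 (i - 1), Q' j))
    (hQ'N : Q' N =
      (∑ j ∈ Finset.Icc 1 N, Q j) - ∑ j ∈ Finset.Icc 1 (N - 1), Q' j)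
    (hW' : ∀ i, 1 ≤ i → i ≤ N - 1 → W' i = Q (i + 1) + W i - Q' i) :
    (∀ i, 1 ≤ i → i ≤ N → 0 ≤ Q' i) ∧
    (∀ i, 1 ≤ i → i ≤ N - 1 → 0 ≤ W' i ∧ Q' i ≤ W i ∧ Q (i + 1) ≤ W' i) ∧
    (∑ i ∈ Finset.Icc 1 N, Q' i) = (∑ i ∈ Finset.Icc 1 N, Q i) ∧
    (Q 1 = 0 → Q' 1 = 0) := by
  have hsucc : ∀ (f : ℕ → ℤ) (i : ℕ), 1 ≤ i →
      ∑ j ∈ Finset.Icc 1 i, f j = (∑ j ∈ Finset.Icc 1 (i - 1), f j) + f i := by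
    intro f i hi
    obtain ⟨k, rfl⟩ : ∃ k, i = k + 1 := ⟨i - 1, by omega⟩
    rw [Finset.sum_Icc_succ_top (by omega), Nat.add_sub_cancel]
  have hle : ∀ i, i ≤ N - 1 →
      ∑ j ∈ Finset.Icc 1 i, Q' j ≤ ∑ j ∈ Finset.Icc 1 i, Q j := by
    intro i hi
    rcases Nat.eq_zero_or_pos i with rfl | hpos
    · simp
    · have h := hQ' i hpos hi
      have hs := hsucc Q' i hpos
      omega
  have hcarry : ∀ i, 1 ≤ i → i ≤ N →
      0 ≤ (∑ j ∈ Finset.Icc 1 i, Q j) - ∑ j ∈ Finset.Icc 1 (i - 1), Q' j := by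
    intro i hi hiN
    have h := hle (i - 1) (by omega)
    have hs := hsucc Q i hi
    have hq := hQnn i hi hiN
    omega
  have hnn : ∀ i, 1 ≤ i → i ≤ N → 0 ≤ Q' i := by
    intro i hi hiN
    have hc := hcarry i hi hiN
    rcases Nat.lt_or_ge i N with hlt | hge
    · rw [hQ' i hi (by omega)]
      exact le_min (hWnn i hi (by omega)) hc
    · obtain rfl : i = N := le_antisymm hiN hge
      rw [hQ'N]
      exact hc
  have hW : ∀ i, 1 ≤ i → i ≤ N - 1 → Q' i ≤ W i := by
    intro i hi hiN
    rw [hQ' i hi hiN]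
    exact min_le_left _ _
  refine ⟨hnn, ?_, ?_, ?_⟩
  · intro i hi hiN
    have h1 := hW i hi hiN
    have h2 := hW' i hi hiN
    have h3 := hQnn (i + 1) (by omega) (by omega)
    exact ⟨by omega, h1, by omega⟩
  · rw [hsucc Q' N hN, hQ'N]
    ring
  · intro h0
    refine le_antisymm ?_ (hnn 1 le_rfl hN)
    rcases Nat.lt_or_ge 1 N with hlt | hge
    · rw [hQ' 1 le_rfl (by omega)]
      exact (min_le_right _ _).trans (by simp [h0])
    · obtain rfl : N = 1 := le_antisymm hge hN
      rw [hQ'N]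
      simp [h0]
end

section
/- The box-ball coordinate dynamics preserves strict positivity of all coordinates: if Q_i ≥ 1 for all 1 ≤ i ≤ N and W_i ≥ 1 for all 1 ≤ i ≤ N−1, then Q'_i ≥ 1 for all 1 ≤ i ≤ N and W'_i ≥ 1 for all 1 ≤ i ≤ N−1; in particular an N-soliton box-ball state evolves to an N-soliton box-ball state. -/
/-- The box-ball coordinate dynamics preserves strict positivity of all coordinates:
an `N`-soliton box-ball state evolves to an `N`-soliton box-ball state. -/
theorem boxball_coord_preserves_positivity (N : ℕ) (hN : 1 ≤ N)
    (Q W Q' W' : ℕ → ℤ)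
    (hQpos : ∀ i, 1 ≤ i → i ≤ N → 1 ≤ Q i)
    (hWpos : ∀ i, 1 ≤ i → i ≤ N - 1 → 1 ≤ W i)
    (hQ' : ∀ i, 1 ≤ i → i ≤ N - 1 →
      Q' i = min (W i)
        ((∑ j ∈ Finset.Icc 1 i, Q j) - ∑ j ∈ Finset.Icc 1 (i - 1), Q' j))
    (hQ'N : Q' N =
      (∑ j ∈ Finset.Icc 1 N, Q j) - ∑ j ∈ Finset.Icc 1 (N - 1), Q' j)
    (hW' : ∀ i, 1 ≤ i → i ≤ N - 1 → W' i = Q (i + 1) + W i - Q' i) :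
    (∀ i, 1 ≤ i → i ≤ N → 1 ≤ Q' i) ∧
    (∀ i, 1 ≤ i → i ≤ N - 1 → 1 ≤ W' i) := by
  have sum_le : ∀ k, k ≤ N - 1 →
      ∑ j ∈ Finset.Icc 1 k, Q' j ≤ ∑ j ∈ Finset.Icc 1 k, Q j := by
    intro k hk
    rcases k with _ | k
    · simp
    · have h := hQ' (k + 1) (by omega) hk
      rw [Nat.add_sub_cancel] at h
      rw [Finset.sum_Icc_succ_top (by omega) Q']
      linarith [h.le.trans (min_le_right _ _)]
  have carrier_pos : ∀ i, 1 ≤ i → i ≤ N →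
      1 ≤ (∑ j ∈ Finset.Icc 1 i, Q j) - ∑ j ∈ Finset.Icc 1 (i - 1), Q' j := by
    intro i hi hiN
    obtain ⟨k, rfl⟩ := Nat.exists_eq_add_of_le' hi
    rw [Nat.add_sub_cancel, Finset.sum_Icc_succ_top (by omega) Q]
    linarith [sum_le k (by omega), hQpos (k + 1) hi hiN]
  refine ⟨fun i hi hiN => ?_, fun i hi hiN => ?_⟩
  · rcases eq_or_ne i N with rfl | hne
    · rw [hQ'N]
      exact carrier_pos i hi le_rfl
    · have hlt : i ≤ N - 1 := by omega
      rw [hQ' i hi hlt]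
      exact le_min (hWpos i hi hlt) (carrier_pos i hi hiN)
  · rw [hW' i hi hiN]
    linarith [(hQ' i hi hiN).le.trans (min_le_left _ _),
      hQpos (i + 1) (by omega) (by omega)]
end

section
/- Let k > l ≥ 1, g ≥ 1 and m ≥ k + l, and let w be the boolean word 1^k 0^g 1^l 0^m. If g ≥ l, then p_i(w) = 2 for 1 ≤ i ≤ l, p_i(w) = 1 for l < i ≤ k, and p_i(w) = 0 for i > k. If g < l, then p_i(w) = 2 for 1 ≤ i ≤ g, p_i(w) = 1 for g < i ≤ k + l − g, and p_i(w) = 0 for i > k + l − g, so that the number of passes removing exactly one pair is k + l − 2g. Equivalently, the 10-elimination invariant p-sequence of w is 2 repeated min(g, l) times followed by 1 repeated (k + l − 2·min(g, l)) times. -/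
/-- One elimination pass: scanning left to right, delete every occurrence of the
consecutive pattern `1,0` (`true, false`). -/
def elimPass : List Bool → List Bool
  | [] => []
  | true :: false :: w => elimPass w
  | c :: w => c :: elimPass w

/-- `tenCount i w` is the number of `10` pairs eliminated at the `i`-th pass
(`i ≥ 1`), i.e. `p_i(w)`. -/
def tenCount (i : ℕ) (w : List Bool) : ℕ :=
  ((elimPass^[i - 1] w).length - (elimPass^[i] w).length) / 2

theorem elimPass_replicate_false_append (b : ℕ) (w : List Bool) :
    elimPass (List.replicate b false ++ w) = List.replicate b false ++ elimPass w := by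
  induction b with
  | zero => rfl
  | succ b ih => simp [List.replicate_succ, elimPass, ih]

theorem elimPass_replicate_true_append (a : ℕ) (w : List Bool) :
    elimPass (List.replicate (a + 1) true ++ false :: w) =
      List.replicate a true ++ elimPass w := by
  induction a with
  | zero => simp [elimPass]
  | succ a ih =>
    simp only [List.replicate_succ, List.cons_append] at ih ⊢
    simp [elimPass, ih]

theorem elimPass_replicate_false (b : ℕ) :
    elimPass (List.replicate b false) = List.replicate b false := by
  simpa [elimPass] using elimPass_replicate_false_append b []

theorem elimPass_one_block (a b : ℕ) :
    elimPass (List.replicate (a + 1) true ++ List.replicate (b + 1) false) =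
      List.replicate a true ++ List.replicate b false := by
  rw [List.replicate_succ (n := b), elimPass_replicate_true_append, elimPass_replicate_false]

theorem elimPass_two_blocks (a b c d : ℕ) :
    elimPass (List.replicate (a + 1) true ++ List.replicate (b + 1) false ++
        List.replicate (c + 1) true ++ List.replicate (d + 1) false) =
      List.replicate a true ++ List.replicate b false ++
        List.replicate c true ++ List.replicate d false := by
  rw [List.replicate_succ (n := b)]
  simp only [List.append_assoc, List.cons_append]
  rw [elimPass_replicate_true_append, elimPass_replicate_false_append, elimPass_one_block]

theorem length_elimPass_iterate_one_block (j a b : ℕ) (hab : a ≤ b) :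
    (elimPass^[j] (List.replicate a true ++ List.replicate b false)).length + 2 * min j a =
      a + b := by
  induction j generalizing a b with
  | zero => simp
  | succ j ih =>
    rw [Function.iterate_succ_apply]
    obtain _ | a := a
    · have h := ih 0 b (by omega)
      simp only [List.replicate_zero, List.nil_append, elimPass_replicate_false] at h ⊢
      omega
    · obtain ⟨b, rfl⟩ : ∃ b', b = b' + 1 := ⟨b - 1, by omega⟩
      have h := ih a b (by omega)
      rw [elimPass_one_block]
      omega

theorem length_elimPass_iterate_two_blocks (j k g l m : ℕ) (hlk : l ≤ k) (hm : k + l ≤ m) :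
    (elimPass^[j] (List.replicate k true ++ List.replicate g false ++
        List.replicate l true ++ List.replicate m false)).length +
      2 * min j (k + l - min g l) + 2 * min j (min g l) = k + g + l + m := by
  induction j generalizing k g l m with
  | zero => simp [add_assoc]
  | succ j ih =>
    obtain _ | g := g
    · have h := length_elimPass_iterate_one_block (j + 1) (k + l) m hm
      rw [List.replicate_zero, List.append_nil, List.replicate_append_replicate]
      omega
    obtain _ | l := l
    · have h := length_elimPass_iterate_one_block (j + 1) k (g + 1 + m) (by omega)
      rw [List.replicate_zero, List.append_nil, List.append_assoc,
        List.replicate_append_replicate]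
      omega
    obtain ⟨k, rfl⟩ : ∃ k', k = k' + 1 := ⟨k - 1, by omega⟩
    obtain ⟨m, rfl⟩ : ∃ m', m = m' + 1 := ⟨m - 1, by omega⟩
    have h := ih k g l m (by omega) (by omega)
    rw [Function.iterate_succ_apply, elimPass_two_blocks]
    omega

/-- Invariant-shape `p`-sequence of the word `1^k 0^g 1^l 0^m` (with `k > l ≥ 1`,
`g ≥ 1`, `m ≥ k + l`): `2` repeated `min(g, l)` times, then `1` repeated
`k + l − 2·min(g, l)` times, then `0`. -/
theorem invariant_shape_two_blocks (k l g m : ℕ)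
    (hl : 1 ≤ l) (hkl : l < k) (hg : 1 ≤ g) (hm : k + l ≤ m) :
    ∀ i : ℕ, 1 ≤ i →
      (i ≤ min g l →
        tenCount i (List.replicate k true ++ List.replicate g false ++
          List.replicate l true ++ List.replicate m false) = 2) ∧
      (min g l < i → i ≤ k + l - min g l →
        tenCount i (List.replicate k true ++ List.replicate g false ++
          List.replicate l true ++ List.replicate m false) = 1) ∧
      (k + l - min g l < i →
        tenCount i (List.replicate k true ++ List.replicate g false ++
          List.replicate l true ++ List.replicate m false) = 0) := by
  intro i hi
  have h₁ := length_elimPass_iterate_two_blocks (i - 1) k g l m hkl.le hm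
  have h₂ := length_elimPass_iterate_two_blocks i k g l m hkl.le hm
  unfold tenCount
  refine ⟨fun h => ?_, fun h h' => ?_, fun h => ?_⟩ <;> omega
end

section
/- Let k, g, l be integers with 1 ≤ l ≤ g < k. Then for every integer t ≥ 2, the t-th iterate of χ applied to (0, 1, k, g, l) equals (0, k+g+1+l(t−2), l, k+l−g+(k−l)(t−2), k). -/
/-- The 3-block box-ball coordinate dynamics on quintuples `(Q₁, W₁, Q₂, W₂, Q₃)`
(with the conventions `W₀ = W₃ = ∞`). -/
def chi (s : ℤ × ℤ × ℤ × ℤ × ℤ) : ℤ × ℤ × ℤ × ℤ × ℤ :=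
  let q1 := s.1
  let w1 := s.2.1
  let q2 := s.2.2.1
  let w2 := s.2.2.2.1
  let q3 := s.2.2.2.2
  let q1' := min w1 q1
  let w1' := q2 + w1 - q1'
  let q2' := min w2 (q1 + q2 - q1')
  let w2' := q3 + w2 - q2'
  let q3' := q1 + q2 + q3 - q1' - q2'
  (q1', w1', q2', w2', q3')

theorem chi_zero_left {w₁ : ℤ} (hw₁ : 0 ≤ w₁) (q₂ w₂ q₃ : ℤ) :
    chi (0, w₁, q₂, w₂, q₃) =
      (0, q₂ + w₁, min w₂ q₂, q₃ + w₂ - min w₂ q₂, q₂ + q₃ - min w₂ q₂) := by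
  simp [chi, min_eq_right hw₁]

/-- Explicit form of the `t`-th iterate (`t ≥ 2`) of the 3-block box-ball dynamics
applied to the augmented 2-soliton initial coordinates `(0, 1, k, g, l)` with
`1 ≤ l ≤ g < k`. -/
theorem two_soliton_iterates (k g l : ℤ)
    (hl : 1 ≤ l) (hlg : l ≤ g) (hgk : g < k) :
    ∀ t : ℕ, 2 ≤ t →
      chi^[t] (0, 1, k, g, l) =
        (0, k + g + 1 + l * ((t : ℤ) - 2), l,
          k + l - g + (k - l) * ((t : ℤ) - 2), k) := by
  intro t ht
  induction t, ht using Nat.le_induction with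
  | base =>
    rw [Function.iterate_succ_apply', Function.iterate_one, chi_zero_left zero_le_one,
      min_eq_left hgk.le, chi_zero_left (w₁ := k + 1) (by lia),
      min_eq_left (a := l + g - g) (by lia)]
    simp only [Prod.mk.injEq]
    push_cast
    lia
  | succ t ht ih =>
    have ht' : 0 ≤ (t : ℤ) - 2 := by lia
    have h₁ : 0 ≤ l * ((t : ℤ) - 2) := mul_nonneg (by lia) ht'
    have h₂ : 0 ≤ (k - l) * ((t : ℤ) - 2) := mul_nonneg (by lia) ht'
    have hw₁ : 0 ≤ k + g + 1 + l * ((t : ℤ) - 2) := by lia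
    have hw₂ : l ≤ k + l - g + (k - l) * ((t : ℤ) - 2) := by lia
    rw [Function.iterate_succ_apply', ih, chi_zero_left hw₁, min_eq_right hw₂]
    simp only [Prod.mk.injEq]
    push_cast
    refine ⟨trivial, ?_, trivial, ?_, ?_⟩ <;> ring
end

section
/- Two-soliton phase shift: let k, g, l be integers with 1 ≤ l ≤ g < k, and for t ≥ 2 write (Q_1^t, W_1^t, Q_2^t, W_2^t, Q_3^t) for the t-th iterate of χ applied to (0, 1, k, g, l). Then for every t ≥ 2: W_1^t + Q_2^t + W_2^t = (1 + k·t) + 2l and W_1^t = (1 + k + g + l·t) − 2l. That is, after the collision has resolved, the k-block (whose leading position is W_1^t + Q_2^t + W_2^t, measured from the stationary filled ghost, and whose free trajectory would be 1 + k·t) has experienced a phase shift of +2l = +2·min(k, l), and the l-block (whose leading position is W_1^t, with free trajectory 1 + k + g + l·t) has experienced a phase shift of −2l = −2·min(k, l). -/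
theorem chi_zero_fst (w a b c : ℤ) (hw : 0 ≤ w) :
    chi (0, w, a, b, c) =
      (0, a + w, min b a, c + b - min b a, a + c - min b a) := by
  simp [chi, min_eq_right hw]

/-- Two separated blocks, the shorter one trailing, move freely. -/
theorem chi_iterate_of_separated (w a b c : ℤ) (hw : 0 ≤ w) (ha : 0 ≤ a) (hab : a ≤ b)
    (hac : a ≤ c) (n : ℕ) :
    chi^[n] (0, w, a, b, c) = (0, w + a * n, a, b + (c - a) * n, c) := by
  induction n with
  | zero => simp
  | succ n ih =>
    have hw' : 0 ≤ w + a * n := by positivity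
    have hb' : a ≤ b + (c - a) * n :=
      le_add_of_le_of_nonneg hab (mul_nonneg (sub_nonneg.2 hac) n.cast_nonneg)
    rw [Function.iterate_succ_apply', ih, chi_zero_fst _ _ _ _ hw', min_eq_right hb']
    simp only [Prod.mk.injEq, true_and]
    push_cast
    refine ⟨?_, ?_, ?_⟩ <;> ring

theorem chi_iterate_two (k g l : ℤ) (hl : 1 ≤ l) (hlg : l ≤ g) (hgk : g < k) :
    chi^[2] (0, 1, k, g, l) = (0, 1 + k + g, l, k + l - g, k) := by
  rw [Function.iterate_succ_apply', Function.iterate_one, chi_zero_fst _ _ _ _ zero_le_one,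
    min_eq_left hgk.le, chi_zero_fst _ _ _ _ (by lia), min_eq_left (by lia)]
  simp only [Prod.mk.injEq, true_and]
  lia

/-- Two-soliton phase shift: for `t ≥ 2`, writing
`(Q₁ᵗ, W₁ᵗ, Q₂ᵗ, W₂ᵗ, Q₃ᵗ) = χᵗ(0, 1, k, g, l)`, the leading position
`W₁ᵗ + Q₂ᵗ + W₂ᵗ` of the `k`-block is `(1 + k·t) + 2l` (a phase shift of
`+2l = +2·min(k,l)` against its free trajectory `1 + k·t`), and the leading
position `W₁ᵗ` of the `l`-block is `(1 + k + g + l·t) − 2l` (a phase shift of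
`−2l = −2·min(k,l)` against its free trajectory `1 + k + g + l·t`). -/
theorem two_soliton_phase_shift (k g l : ℤ)
    (hl : 1 ≤ l) (hlg : l ≤ g) (hgk : g < k) :
    ∀ t : ℕ, 2 ≤ t →
      ((chi^[t] (0, 1, k, g, l)).2.1 + (chi^[t] (0, 1, k, g, l)).2.2.1 +
          (chi^[t] (0, 1, k, g, l)).2.2.2.1 = (1 + k * (t : ℤ)) + 2 * min k l) ∧
      ((chi^[t] (0, 1, k, g, l)).2.1 = (1 + k + g + l * (t : ℤ)) - 2 * min k l) := by
  intro t ht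
  obtain ⟨n, rfl⟩ := Nat.exists_eq_add_of_le' ht
  rw [Function.iterate_add_apply, chi_iterate_two k g l hl hlg hgk,
    chi_iterate_of_separated _ _ _ _ (by lia) (by lia) (by lia) (by lia),
    min_eq_right (by lia)]
  push_cast
  constructor <;> ring
end
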